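/- Let (M,·,1) be a commutative monoid and let S be a naturally ordered ω-continuous M-module. Then for every M-wGCL program C, the transformer wp[C] is homogeneous: for all a ∈ M and all weightings f, wp[C](a ⊗ f) = a ⊗ wp[C](f). -/

import Mathlib

/-! ## Monoid modules, natural order, ω-(co)continuity -/

structure MonModule (M : Type) [Monoid M] (S : Type) where
  add : S → S → S
  zero : S
  smul : M → S → S
  add_assoc : ∀ a b c : S, add (add a b) c = add a (add b c)
  add_comm : ∀ a b : S, add a b = add b a
  add_zero : ∀ a : S, add a zero = a
  smul_assoc : ∀ (u v : M) (a : S), smul (u * v) a = smul u (smul v a)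
  smul_add : ∀ (u : M) (a b : S), smul u (add a b) = add (smul u a) (smul u b)
  one_smul : ∀ a : S, smul 1 a = a
  smul_zero : ∀ u : M, smul u zero = zero

namespace MonModule

variable {M S : Type} [Monoid M]

/-- The natural (pre)order: `a ⪯ b` iff `∃ c, a ⊕ c = b`. -/
def le (mm : MonModule M S) (a b : S) : Prop := ∃ c : S, mm.add a c = b

/-- `S` is naturally ordered if the natural order is antisymmetric (hence a partial order). -/
def NaturallyOrdered (mm : MonModule M S) : Prop :=
  ∀ a b : S, mm.le a b → mm.le b a → a = b

/-- ω-chain (ascending). -/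
def Chain (mm : MonModule M S) (s : ℕ → S) : Prop := ∀ n : ℕ, mm.le (s n) (s (n + 1))

/-- ω-descending chain. -/
def DChain (mm : MonModule M S) (s : ℕ → S) : Prop := ∀ n : ℕ, mm.le (s (n + 1)) (s n)

/-- `x` is the supremum (least upper bound) of `s` w.r.t. the natural order. -/
def IsSup (mm : MonModule M S) (s : ℕ → S) (x : S) : Prop :=
  (∀ n : ℕ, mm.le (s n) x) ∧ ∀ y : S, (∀ n : ℕ, mm.le (s n) y) → mm.le x y

/-- `x` is the infimum (greatest lower bound) of `s` w.r.t. the natural order. -/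
def IsInf (mm : MonModule M S) (s : ℕ → S) (x : S) : Prop :=
  (∀ n : ℕ, mm.le x (s n)) ∧ ∀ y : S, (∀ n : ℕ, mm.le y (s n)) → mm.le y x

end MonModule

/-- `S` is ω-continuous: suprema of ω-chains exist (with least element `𝟘`, which is
automatically least for the natural order), and `⊕`, `⊗` are ω-continuous. -/
structure OmegaContinuous {M S : Type} [Monoid M] (mm : MonModule M S) : Prop where
  sup_exists : ∀ s : ℕ → S, mm.Chain s → ∃ x : S, mm.IsSup s x
  add_cont : ∀ (a : S) (s : ℕ → S) (x : S), mm.Chain s → mm.IsSup s x →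
    mm.IsSup (fun n => mm.add a (s n)) (mm.add a x)
  smul_cont : ∀ (u : M) (s : ℕ → S) (x : S), mm.Chain s → mm.IsSup s x →
    mm.IsSup (fun n => mm.smul u (s n)) (mm.smul u x)

/-- `S` is ω-cocontinuous: a greatest element exists, infima of ω-descending chains exist,
and `⊕`, `⊗` are ω-cocontinuous. -/
structure OmegaCocontinuous {M S : Type} [Monoid M] (mm : MonModule M S) : Prop where
  top_exists : ∃ t : S, ∀ a : S, mm.le a t
  inf_exists : ∀ s : ℕ → S, mm.DChain s → ∃ x : S, mm.IsInf s x
  add_cocont : ∀ (a : S) (s : ℕ → S) (x : S), mm.DChain s → mm.IsInf s x →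
    mm.IsInf (fun n => mm.add a (s n)) (mm.add a x)
  smul_cocont : ∀ (u : M) (s : ℕ → S) (x : S), mm.DChain s → mm.IsInf s x →
    mm.IsInf (fun n => mm.smul u (s n)) (mm.smul u x)

def OmegaBicontinuous {M S : Type} [Monoid M] (mm : MonModule M S) : Prop :=
  OmegaContinuous mm ∧ OmegaCocontinuous mm

/-! ## Weightings (pointwise lifting to `St → S`) -/

section Weightings

variable {M S St : Type} [Monoid M]

/-- Pointwise natural order on weightings. -/
def wle (mm : MonModule M S) (f g : St → S) : Prop := ∀ σ : St, mm.le (f σ) (g σ)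

def WChain (mm : MonModule M S) (s : ℕ → St → S) : Prop := ∀ n : ℕ, wle mm (s n) (s (n + 1))

def WDChain (mm : MonModule M S) (s : ℕ → St → S) : Prop := ∀ n : ℕ, wle mm (s (n + 1)) (s n)

def WIsSup (mm : MonModule M S) (s : ℕ → St → S) (x : St → S) : Prop :=
  (∀ n : ℕ, wle mm (s n) x) ∧ ∀ y : St → S, (∀ n : ℕ, wle mm (s n) y) → wle mm x y

def WIsInf (mm : MonModule M S) (s : ℕ → St → S) (x : St → S) : Prop :=
  (∀ n : ℕ, wle mm x (s n)) ∧ ∀ y : St → S, (∀ n : ℕ, wle mm y (s n)) → wle mm y x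

end Weightings

/-! ## wGCL syntax -/

/-- wGCL programs over weights from `M` and program states from `St`:
assignments (as state transformations), sequencing, conditionals, nondeterministic
branching, weighting `⊙ a`, and loops. -/
inductive WGCL (M : Type) (St : Type) : Type
  | assign : (St → St) → WGCL M St
  | seq : WGCL M St → WGCL M St → WGCL M St
  | ite : Set St → WGCL M St → WGCL M St → WGCL M St
  | branch : WGCL M St → WGCL M St → WGCL M St
  | weight : M → WGCL M St
  | wloop : Set St → WGCL M St → WGCL M St

section Transformers

variable {M S St : Type} [Monoid M]

/-- Iverson-bracket guarding `[φ] ⋄ f`. -/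
noncomputable def iv (mm : MonModule M S) (φ : Set St) (f : St → S) : St → S :=
  fun σ => @ite _ (σ ∈ φ) (Classical.propDecidable _) (f σ) mm.zero

/-- Least fixed point of `Φ` w.r.t. the pointwise natural order (chosen by classical choice
if it exists; arbitrary otherwise). -/
noncomputable def wlfp (mm : MonModule M S) (Φ : (St → S) → St → S) : St → S :=
  @dite _ (∃ x : St → S, Φ x = x ∧ ∀ y : St → S, Φ y = y → wle mm x y)
    (Classical.propDecidable _) (fun h => h.choose) (fun _ => fun _ => mm.zero)

/-- Greatest fixed point of `Φ` w.r.t. the pointwise natural order. -/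
noncomputable def wgfp (mm : MonModule M S) (Φ : (St → S) → St → S) : St → S :=
  @dite _ (∃ x : St → S, Φ x = x ∧ ∀ y : St → S, Φ y = y → wle mm y x)
    (Classical.propDecidable _) (fun h => h.choose) (fun _ => fun _ => mm.zero)

/-- Weakest preweighting transformer `wp`. -/
noncomputable def wp (mm : MonModule M S) : WGCL M St → (St → S) → St → S
  | WGCL.assign g => fun f σ => f (g σ)
  | WGCL.seq C₁ C₂ => fun f => wp mm C₁ (wp mm C₂ f)
  | WGCL.ite φ C₁ C₂ => fun f σ => mm.add (iv mm φ (wp mm C₁ f) σ) (iv mm φᶜ (wp mm C₂ f) σ)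
  | WGCL.branch C₁ C₂ => fun f σ => mm.add (wp mm C₁ f σ) (wp mm C₂ f σ)
  | WGCL.weight a => fun f σ => mm.smul a (f σ)
  | WGCL.wloop φ C' => fun f =>
      wlfp mm (fun X σ => mm.add (iv mm φᶜ f σ) (iv mm φ (wp mm C' X) σ))

/-- The `wp`-characteristic function `Φ_f(X) = [¬φ]⋄f ⊕ [φ]⋄wp[C'](X)` of `while(φ){C'}`. -/
noncomputable def charW (mm : MonModule M S) (φ : Set St) (C' : WGCL M St) (f : St → S)
    (X : St → S) : St → S :=
  fun σ => mm.add (iv mm φᶜ f σ) (iv mm φ (wp mm C' X) σ)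

/-- Weakest liberal preweighting transformer `wlp`. -/
noncomputable def wlp (mm : MonModule M S) : WGCL M St → (St → S) → St → S
  | WGCL.assign g => fun f σ => f (g σ)
  | WGCL.seq C₁ C₂ => fun f => wlp mm C₁ (wlp mm C₂ f)
  | WGCL.ite φ C₁ C₂ => fun f σ => mm.add (iv mm φ (wlp mm C₁ f) σ) (iv mm φᶜ (wlp mm C₂ f) σ)
  | WGCL.branch C₁ C₂ => fun f σ => mm.add (wlp mm C₁ f σ) (wlp mm C₂ f σ)
  | WGCL.weight a => fun f σ => mm.smul a (f σ)
  | WGCL.wloop φ C' => fun f =>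
      wgfp mm (fun X σ => mm.add (iv mm φᶜ f σ) (iv mm φ (wlp mm C' X) σ))

/-- The `wlp`-characteristic function `Ψ_f(X) = [¬φ]⋄f ⊕ [φ]⋄wlp[C'](X)` of `while(φ){C'}`. -/
noncomputable def charWlp (mm : MonModule M S) (φ : Set St) (C' : WGCL M St) (f : St → S)
    (X : St → S) : St → S :=
  fun σ => mm.add (iv mm φᶜ f σ) (iv mm φ (wlp mm C' X) σ)

end Transformers

/-! ## Operational semantics -/

/-- Configurations: `none` is a terminal configuration. -/
abbrev Conf (M St : Type) := Option (WGCL M St) × St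

section Operational

variable {M St : Type} [Monoid M]

/-- Weighted small-step operational semantics: each transition carries a weight in `M`
(the weight `a` for executing `⊙ a`, and `1` otherwise). -/
inductive Step : Conf M St → M → Conf M St → Prop
  | assign (g : St → St) (σ : St) : Step (some (WGCL.assign g), σ) 1 (none, g σ)
  | weight (a : M) (σ : St) : Step (some (WGCL.weight a), σ) a (none, σ)
  | seq_fin {C₁ : WGCL M St} {σ : St} {w : M} {σ' : St} (C₂ : WGCL M St) :
      Step (some C₁, σ) w (none, σ') → Step (some (WGCL.seq C₁ C₂), σ) w (some C₂, σ')
  | seq_step {C₁ : WGCL M St} {σ : St} {w : M} {C₁' : WGCL M St} {σ' : St} (C₂ : WGCL M St) :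
      Step (some C₁, σ) w (some C₁', σ') →
      Step (some (WGCL.seq C₁ C₂), σ) w (some (WGCL.seq C₁' C₂), σ')
  | ite_left {φ : Set St} {σ : St} (C₁ C₂ : WGCL M St) :
      σ ∈ φ → Step (some (WGCL.ite φ C₁ C₂), σ) 1 (some C₁, σ)
  | ite_right {φ : Set St} {σ : St} (C₁ C₂ : WGCL M St) :
      σ ∉ φ → Step (some (WGCL.ite φ C₁ C₂), σ) 1 (some C₂, σ)
  | branch_left (C₁ C₂ : WGCL M St) (σ : St) :
      Step (some (WGCL.branch C₁ C₂), σ) 1 (some C₁, σ)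
  | branch_right (C₁ C₂ : WGCL M St) (σ : St) :
      Step (some (WGCL.branch C₁ C₂), σ) 1 (some C₂, σ)
  | loop_enter {φ : Set St} {σ : St} (C : WGCL M St) :
      σ ∈ φ → Step (some (WGCL.wloop φ C), σ) 1 (some (WGCL.seq C (WGCL.wloop φ C)), σ)
  | loop_exit {φ : Set St} {σ : St} (C : WGCL M St) :
      σ ∉ φ → Step (some (WGCL.wloop φ C), σ) 1 (none, σ)

/-- A finite computation path from configuration `c`, recorded as the list of
(transition weight, successor configuration) pairs. -/
inductive Steps : Conf M St → List (M × Conf M St) → Prop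
  | nil (c : Conf M St) : Steps c []
  | cons {c : Conf M St} {w : M} {c' : Conf M St} {l : List (M × Conf M St)} :
      Step c w c' → Steps c' l → Steps c ((w, c') :: l)

/-- Weight of a computation path: the ordered product of its transition weights. -/
def pathWeight (l : List (M × Conf M St)) : M := (l.map Prod.fst).prod

/-- Final state of a (nonempty) computation path; `σ` for the empty path. -/
def lastState (σ : St) (l : List (M × Conf M St)) : St :=
  (l.getLastD ((1 : M), ((none : Option (WGCL M St)), σ))).2.2

/-- A terminating computation path from `c`: a finite path ending in a terminal
configuration. -/
def TermPath (c : Conf M St) (l : List (M × Conf M St)) : Prop :=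
  Steps c l ∧ ∃ p : M × Conf M St, l.getLast? = some p ∧ p.2.1 = (none : Option (WGCL M St))

/-- There is an infinite computation path starting in `c`. -/
def InfinitePathFrom (c : Conf M St) : Prop :=
  ∃ π : ℕ → Conf M St, π 0 = c ∧ ∀ n : ℕ, ∃ w : M, Step (π n) w (π (n + 1))

end Operational

/-! ## Countable module sums as suprema of finite partial sums -/

section Sums

variable {M S : Type} [Monoid M]

/-- Finite sum of `g` over the elements of a list. -/
def finListSum (mm : MonModule M S) {ι : Type} (g : ι → S) : List ι → S
  | [] => mm.zero
  | i :: t => mm.add (g i) (finListSum mm g t)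

/-- `x` is the (countable) module sum `⨁_{i ∈ T} g i`, i.e. the least upper bound
of all finite partial sums over duplicate-free lists of elements of `T`. -/
def IsSumOver (mm : MonModule M S) {ι : Type} (T : Set ι) (g : ι → S) (x : S) : Prop :=
  (∀ l : List ι, l.Nodup → (∀ i ∈ l, i ∈ T) → mm.le (finListSum mm g l) x) ∧
  ∀ y : S, (∀ l : List ι, l.Nodup → (∀ i ∈ l, i ∈ T) → mm.le (finListSum mm g l) y) → mm.le x y

end Sums

namespace MonModule

section Order

variable {M S : Type} [Monoid M] (mm : MonModule M S)

theorem le_refl (a : S) : mm.le a a := ⟨mm.zero, mm.add_zero a⟩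

variable {mm}

theorem le_trans {a b c : S} : mm.le a b → mm.le b c → mm.le a c := by
  rintro ⟨d, rfl⟩ ⟨e, rfl⟩
  exact ⟨mm.add d e, (mm.add_assoc a d e).symm⟩

variable (mm) in
theorem zero_le (a : S) : mm.le mm.zero a := ⟨a, by rw [mm.add_comm, mm.add_zero]⟩

theorem add_le_add_left {a b : S} (c : S) (h : mm.le a b) : mm.le (mm.add c a) (mm.add c b) := by
  obtain ⟨d, rfl⟩ := h
  exact ⟨d, mm.add_assoc c a d⟩

theorem add_le_add {a b c d : S} (hab : mm.le a b) (hcd : mm.le c d) :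
    mm.le (mm.add a c) (mm.add b d) := by
  refine le_trans (add_le_add_left a hcd) ?_
  rw [mm.add_comm a, mm.add_comm b]
  exact add_le_add_left d hab

theorem smul_le_smul {a b : S} (u : M) (h : mm.le a b) : mm.le (mm.smul u a) (mm.smul u b) := by
  obtain ⟨c, rfl⟩ := h
  exact ⟨mm.smul u c, (mm.smul_add u a c).symm⟩

theorem Chain.le_of_le {s : ℕ → S} (hs : mm.Chain s) {m n : ℕ} (h : m ≤ n) :
    mm.le (s m) (s n) := by
  induction n, h using Nat.le_induction with
  | base => exact mm.le_refl _
  | succ n _ ih => exact le_trans ih (hs n)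

variable (mm) in
theorem isSup_const (a : S) : mm.IsSup (fun _ => a) a :=
  ⟨fun _ => mm.le_refl a, fun _ h => h 0⟩

theorem IsSup.unique (hord : mm.NaturallyOrdered) {s : ℕ → S} {x y : S} (hx : mm.IsSup s x)
    (hy : mm.IsSup s y) : x = y :=
  hord _ _ (hx.2 y hy.1) (hy.2 x hx.1)

theorem IsSup.succ {s : ℕ → S} {x : S} (hs : mm.Chain s) (hx : mm.IsSup s x) :
    mm.IsSup (fun n => s (n + 1)) x :=
  ⟨fun n => hx.1 (n + 1), fun y h => hx.2 y fun n => le_trans (hs n) (h n)⟩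

theorem IsSup.add (hcont : OmegaContinuous mm) {s t : ℕ → S} {x y : S} (hs : mm.Chain s)
    (ht : mm.Chain t) (hx : mm.IsSup s x) (hy : mm.IsSup t y) :
    mm.IsSup (fun n => mm.add (s n) (t n)) (mm.add x y) := by
  refine ⟨fun n => add_le_add (hx.1 n) (hy.1 n), fun z hz => ?_⟩
  rw [mm.add_comm]
  refine (hcont.add_cont y s x hs hx).2 z fun m => ?_
  change mm.le (mm.add y (s m)) z
  rw [mm.add_comm]
  refine (hcont.add_cont (s m) t y ht hy).2 z fun n => ?_
  exact le_trans (add_le_add (hs.le_of_le (le_max_left m n)) (ht.le_of_le (le_max_right m n)))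
    (hz (max m n))

end Order

section Weightings

variable {M S St : Type} [Monoid M] {mm : MonModule M S}

theorem iv_mono (φ : Set St) {f g : St → S} (h : wle mm f g) : wle mm (iv mm φ f) (iv mm φ g) := by
  intro σ
  by_cases hσ : σ ∈ φ
  · simpa only [iv, if_pos hσ] using h σ
  · simpa only [iv, if_neg hσ] using mm.le_refl mm.zero

theorem IsSup.iv (φ : Set St) {s : ℕ → St → S} {x : St → S} {σ : St}
    (h : mm.IsSup (fun n => s n σ) (x σ)) : mm.IsSup (fun n => iv mm φ (s n) σ) (iv mm φ x σ) := by
  by_cases hσ : σ ∈ φ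
  · simpa only [_root_.iv, if_pos hσ] using h
  · simpa only [_root_.iv, if_neg hσ] using mm.isSup_const mm.zero

theorem iv_smul (φ : Set St) (a : M) (f : St → S) (σ : St) :
    iv mm φ (fun τ => mm.smul a (f τ)) σ = mm.smul a (iv mm φ f σ) := by
  by_cases hσ : σ ∈ φ
  · simp only [iv, if_pos hσ]
  · simp only [iv, if_neg hσ, mm.smul_zero]

/-- `T` is monotone and preserves (pointwise) suprema of ω-chains of weightings. -/
structure TransformerContinuous (mm : MonModule M S) (T : (St → S) → St → S) : Prop where
  mono : ∀ f g : St → S, wle mm f g → wle mm (T f) (T g)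
  isSup : ∀ (s : ℕ → St → S) (x : St → S), WChain mm s →
    (∀ σ, mm.IsSup (fun n => s n σ) (x σ)) → ∀ σ, mm.IsSup (fun n => T (s n) σ) (T x σ)

/-- The `n`-th Kleene iterate of `Φ` from the zero weighting. -/
def kleene (mm : MonModule M S) (Φ : (St → S) → St → S) (n : ℕ) : St → S :=
  Φ^[n] fun _ => mm.zero

theorem kleene_succ (Φ : (St → S) → St → S) (n : ℕ) :
    kleene mm Φ (n + 1) = Φ (kleene mm Φ n) :=
  Function.iterate_succ_apply' _ _ _

namespace TransformerContinuous

variable {Φ : (St → S) → St → S}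

theorem wChain_kleene (hΦ : TransformerContinuous mm Φ) : WChain mm (kleene mm Φ) := by
  intro n
  induction n with
  | zero => exact fun σ => mm.zero_le _
  | succ n ih =>
    rw [kleene_succ Φ n, kleene_succ Φ (n + 1)]
    exact hΦ.mono _ _ ih

/-- Kleene's fixed point theorem. -/
theorem isSup_wlfp (hord : mm.NaturallyOrdered) (hcont : OmegaContinuous mm)
    (hΦ : TransformerContinuous mm Φ) (σ : St) :
    mm.IsSup (fun n => kleene mm Φ n σ) (wlfp mm Φ σ) := by
  have hchain (τ : St) : mm.Chain fun n => kleene mm Φ n τ := fun n => hΦ.wChain_kleene n τ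
  choose x hx using fun τ => hcont.sup_exists _ (hchain τ)
  have hfix : Φ x = x := by
    funext τ
    refine (hΦ.isSup _ x hΦ.wChain_kleene hx τ).unique hord ?_
    simpa only [kleene_succ] using (hx τ).succ (hchain τ)
  have hleast (y : St → S) (hy : Φ y = y) : wle mm x y := by
    have hle (n : ℕ) : wle mm (kleene mm Φ n) y := by
      induction n with
      | zero => exact fun τ => mm.zero_le _
      | succ n ih =>
        rw [kleene_succ, ← hy]
        exact hΦ.mono _ _ ih
    exact fun τ => (hx τ).2 _ fun n => hle n τ
  have hex : ∃ x : St → S, Φ x = x ∧ ∀ y : St → S, Φ y = y → wle mm x y := ⟨x, hfix, hleast⟩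
  have heq : wlfp mm Φ = x := by
    rw [wlfp, dif_pos hex]
    funext τ
    exact hord _ _ (hex.choose_spec.2 x hfix τ) (hleast _ hex.choose_spec.1 τ)
  rw [heq]
  exact hx σ

end TransformerContinuous

/-- The characteristic function of a loop with guard `φ` whose body has transformer `T`. -/
noncomputable def loopStep (mm : MonModule M S) (φ : Set St) (T : (St → S) → St → S)
    (f X : St → S) : St → S :=
  fun σ => mm.add (iv mm φᶜ f σ) (iv mm φ (T X) σ)

variable {T : (St → S) → St → S}

theorem loopStep_mono (φ : Set St) (hT : TransformerContinuous mm T) {f g X Y : St → S}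
    (hfg : wle mm f g) (hXY : wle mm X Y) :
    wle mm (loopStep mm φ T f X) (loopStep mm φ T g Y) :=
  fun σ => add_le_add (iv_mono φᶜ hfg σ) (iv_mono φ (hT.mono _ _ hXY) σ)

theorem isSup_loopStep (hcont : OmegaContinuous mm) (φ : Set St) (hT : TransformerContinuous mm T)
    {s t : ℕ → St → S} {x y : St → S} (hs : WChain mm s) (ht : WChain mm t)
    (hx : ∀ σ, mm.IsSup (fun n => s n σ) (x σ)) (hy : ∀ σ, mm.IsSup (fun n => t n σ) (y σ))
    (σ : St) :
    mm.IsSup (fun n => loopStep mm φ T (s n) (t n) σ) (loopStep mm φ T x y σ) :=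
  IsSup.add hcont (fun n => iv_mono φᶜ (hs n) σ) (fun n => iv_mono φ (hT.mono _ _ (ht n)) σ)
    ((hx σ).iv φᶜ) (IsSup.iv (s := fun n => T (t n)) φ (hT.isSup t y ht hy σ))

theorem transformerContinuous_loopStep (hcont : OmegaContinuous mm) (φ : Set St)
    (hT : TransformerContinuous mm T) (f : St → S) :
    TransformerContinuous mm (loopStep mm φ T f) where
  mono _ _ h := loopStep_mono φ hT (fun _ => mm.le_refl _) h
  isSup _ _ ht hy := isSup_loopStep hcont φ hT (fun _ _ => mm.le_refl _) ht
    (fun _ => mm.isSup_const _) hy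

theorem kleene_loopStep_mono (φ : Set St) (hT : TransformerContinuous mm T) {f g : St → S}
    (hfg : wle mm f g) (k : ℕ) :
    wle mm (kleene mm (loopStep mm φ T f) k) (kleene mm (loopStep mm φ T g) k) := by
  induction k with
  | zero => exact fun _ => mm.le_refl _
  | succ k ih =>
    rw [kleene_succ, kleene_succ]
    exact loopStep_mono φ hT hfg ih

theorem isSup_kleene_loopStep (hcont : OmegaContinuous mm) (φ : Set St)
    (hT : TransformerContinuous mm T) {s : ℕ → St → S} {x : St → S} (hs : WChain mm s)
    (hx : ∀ σ, mm.IsSup (fun n => s n σ) (x σ)) (k : ℕ) (σ : St) :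
    mm.IsSup (fun n => kleene mm (loopStep mm φ T (s n)) k σ)
      (kleene mm (loopStep mm φ T x) k σ) := by
  induction k generalizing σ with
  | zero => exact mm.isSup_const _
  | succ k ih =>
    simp only [kleene_succ]
    exact isSup_loopStep hcont φ hT hs (fun n => kleene_loopStep_mono φ hT (hs n) k) hx ih σ

theorem transformerContinuous_wlfp_loopStep (hord : mm.NaturallyOrdered)
    (hcont : OmegaContinuous mm) (φ : Set St) (hT : TransformerContinuous mm T) :
    TransformerContinuous mm fun f => wlfp mm (loopStep mm φ T f) := by
  have hsup (f : St → S) (σ : St) :=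
    (transformerContinuous_loopStep hcont φ hT f).isSup_wlfp hord hcont σ
  have hmono (f g : St → S) (h : wle mm f g) :
      wle mm (wlfp mm (loopStep mm φ T f)) (wlfp mm (loopStep mm φ T g)) := fun σ =>
    (hsup f σ).2 _ fun k => le_trans (kleene_loopStep_mono φ hT h k σ) ((hsup g σ).1 k)
  refine ⟨hmono, fun s x hs hx σ => ⟨fun n => hmono _ _ (fun τ => (hx τ).1 n) σ, fun z hz => ?_⟩⟩
  refine (hsup x σ).2 z fun k => (isSup_kleene_loopStep hcont φ hT hs hx k σ).2 z fun n => ?_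
  exact le_trans ((hsup (s n) σ).1 k) (hz n)

theorem wlfp_loopStep_smul (hord : mm.NaturallyOrdered) (hcont : OmegaContinuous mm) (φ : Set St)
    (hT : TransformerContinuous mm T) (a : M)
    (hsmul : ∀ f : St → S, T (fun σ => mm.smul a (f σ)) = fun σ => mm.smul a (T f σ))
    (f : St → S) :
    wlfp mm (loopStep mm φ T fun σ => mm.smul a (f σ)) =
      fun σ => mm.smul a (wlfp mm (loopStep mm φ T f) σ) := by
  have hkleene (k : ℕ) : kleene mm (loopStep mm φ T fun σ => mm.smul a (f σ)) k =
      fun σ => mm.smul a (kleene mm (loopStep mm φ T f) k σ) := by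
    induction k with
    | zero => exact funext fun _ => (mm.smul_zero a).symm
    | succ k ih =>
      rw [kleene_succ, kleene_succ, ih]
      funext σ
      simp only [loopStep, hsmul, iv_smul, mm.smul_add]
  have hf := transformerContinuous_loopStep hcont φ hT f
  funext σ
  refine ((transformerContinuous_loopStep hcont φ hT _).isSup_wlfp hord hcont σ).unique hord ?_
  simpa only [hkleene] using hcont.smul_cont a _ _ (fun n => hf.wChain_kleene n σ)
    (hf.isSup_wlfp hord hcont σ)

theorem transformerContinuous_wp (hord : mm.NaturallyOrdered) (hcont : OmegaContinuous mm)
    (C : WGCL M St) : TransformerContinuous mm (wp mm C) := by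
  induction C with
  | assign g => exact ⟨fun _ _ h σ => h (g σ), fun _ _ _ hx σ => hx (g σ)⟩
  | seq C₁ C₂ ih₁ ih₂ =>
    exact ⟨fun _ _ h => ih₁.mono _ _ (ih₂.mono _ _ h), fun s x hs hx =>
      ih₁.isSup _ _ (fun n => ih₂.mono _ _ (hs n)) (ih₂.isSup s x hs hx)⟩
  | ite φ C₁ C₂ ih₁ ih₂ =>
    refine ⟨fun _ _ h σ => add_le_add (iv_mono φ (ih₁.mono _ _ h) σ)
      (iv_mono φᶜ (ih₂.mono _ _ h) σ), fun s x hs hx σ => ?_⟩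
    exact IsSup.add hcont (fun n => iv_mono φ (ih₁.mono _ _ (hs n)) σ)
      (fun n => iv_mono φᶜ (ih₂.mono _ _ (hs n)) σ)
      (IsSup.iv (s := fun n => wp mm C₁ (s n)) φ (ih₁.isSup s x hs hx σ))
      (IsSup.iv (s := fun n => wp mm C₂ (s n)) φᶜ (ih₂.isSup s x hs hx σ))
  | branch C₁ C₂ ih₁ ih₂ =>
    exact ⟨fun _ _ h σ => add_le_add (ih₁.mono _ _ h σ) (ih₂.mono _ _ h σ), fun s x hs hx σ =>
      IsSup.add hcont (fun n => ih₁.mono _ _ (hs n) σ) (fun n => ih₂.mono _ _ (hs n) σ)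
        (ih₁.isSup s x hs hx σ) (ih₂.isSup s x hs hx σ)⟩
  | weight a =>
    exact ⟨fun _ _ h σ => smul_le_smul a (h σ), fun s x hs hx σ =>
      hcont.smul_cont a _ _ (fun n => hs n σ) (hx σ)⟩
  | wloop φ C ih => exact transformerContinuous_wlfp_loopStep hord hcont φ ih

end Weightings

end MonModule

/-- **Homogeneity of wp** for commutative weight monoids: if `M` is commutative and `S`
is a naturally ordered ω-continuous `M`-module, then `wp[C](a ⊗ f) = a ⊗ wp[C](f)`. -/
theorem wp_homogeneous (M S St : Type) [CommMonoid M] [Countable St] (mm : MonModule M S)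
    (hord : mm.NaturallyOrdered) (hcont : OmegaContinuous mm) :
    ∀ (C : WGCL M St) (a : M) (f : St → S),
      wp mm C (fun σ => mm.smul a (f σ)) = fun σ => mm.smul a (wp mm C f σ) := by
  intro C a
  induction C with
  | assign g => exact fun _ => rfl
  | seq C₁ C₂ ih₁ ih₂ =>
    intro f
    simp only [wp, ih₂, ih₁]
  | ite φ C₁ C₂ ih₁ ih₂ =>
    intro f
    simp only [wp, ih₁, ih₂, MonModule.iv_smul, mm.smul_add]
  | branch C₁ C₂ ih₁ ih₂ =>
    intro f
    simp only [wp, ih₁, ih₂, mm.smul_add]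
  | weight b =>
    intro f
    simp only [wp, ← mm.smul_assoc, mul_comm]
  | wloop φ C ih =>
    exact MonModule.wlfp_loopStep_smul hord hcont φ
      (MonModule.transformerContinuous_wp hord hcont C) a ih
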